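/- Let A be a C*-algebra, let a be a positive element in M_∞(A), and let p be a projection in M_∞(A) with p Cuntz subequivalent to a. Then there exists a positive element b in M_∞(A) such that p ⊕ b is Cuntz equivalent to a. -/

import Mathlib

open Filter Topology
open scoped ENNReal NNReal

variable {A : Type*}

/-- Cuntz subequivalence: `a ≾ b` iff `vₙ * b * vₙ* → a` for some sequence `vₙ`. -/
def CuntzSub [NonUnitalRing A] [StarRing A] [TopologicalSpace A] (a b : A) : Prop :=
  ∃ v : ℕ → A, Tendsto (fun n => v n * b * star (v n)) atTop (nhds a)

/-- Cuntz equivalence. -/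
def CuntzEquiv [NonUnitalRing A] [StarRing A] [TopologicalSpace A] (a b : A) : Prop :=
  CuntzSub a b ∧ CuntzSub b a

/-- `(a - ε)₊`, the positive part of `a - ε`, via continuous functional calculus. -/
noncomputable def cutoff [CStarAlgebra A] (ε : ℝ) (a : A) : A :=
  cfc (fun t : ℝ => max (t - ε) 0) a
/-- Positivity in a matrix algebra over a C*-algebra (or any star ring). -/
def MatPos {R : Type*} [NonUnitalRing R] [StarRing R] {n : ℕ}
    (a : Matrix (Fin n) (Fin n) R) : Prop :=
  ∃ c : Matrix (Fin n) (Fin n) R, a = star c * c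

/-- Padding a square matrix to a larger size with zeros (corner embedding). -/
def pad {A : Type*} {n m : ℕ} [Zero A] (_ : n ≤ m) (a : Matrix (Fin n) (Fin n) A) :
    Matrix (Fin m) (Fin m) A := fun i j =>
  if hi : (i : ℕ) < n then if hj : (j : ℕ) < n then a ⟨i, hi⟩ ⟨j, hj⟩ else 0 else 0

/-- `k`-fold diagonal repetition of a square matrix. -/
def rep {A : Type*} {n : ℕ} [Zero A] (k : ℕ) (a : Matrix (Fin n) (Fin n) A) :
    Matrix (Fin (n * k)) (Fin (n * k)) A :=
  Matrix.reindex finProdFinEquiv finProdFinEquiv (Matrix.blockDiagonal fun _ : Fin k => a)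

/-- Direct sum `a ⊕ b` of square matrices. -/
def dsum {A : Type*} {n m : ℕ} [Zero A] (a : Matrix (Fin n) (Fin n) A)
    (b : Matrix (Fin m) (Fin m) A) : Matrix (Fin (n + m)) (Fin (n + m)) A :=
  Matrix.reindex finSumFinEquiv finSumFinEquiv (Matrix.fromBlocks a 0 0 b)

/-- Cuntz subequivalence for matrices of different sizes over `A`
(i.e. in `M_∞(A)`), via corner embeddings into a common size. -/
def CuntzSubM {A : Type*} [CStarAlgebra A] {n m : ℕ} (a : Matrix (Fin n) (Fin n) A)
    (b : Matrix (Fin m) (Fin m) A) : Prop :=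
  CuntzSub (pad (le_max_left n m) a) (pad (le_max_right n m) b)

/-- Cuntz equivalence in `M_∞(A)`. -/
def CuntzEquivM {A : Type*} [CStarAlgebra A] {n m : ℕ} (a : Matrix (Fin n) (Fin n) A)
    (b : Matrix (Fin m) (Fin m) A) : Prop :=
  CuntzSubM a b ∧ CuntzSubM b a

/-- The Cuntz semigroup `W(A)` is almost unperforated:
`(k+1)⟨a⟩ ≤ k⟨b⟩` implies `⟨a⟩ ≤ ⟨b⟩`. -/
def AlmostUnperforated (A : Type*) [CStarAlgebra A] : Prop :=
  ∀ (n m k : ℕ) (a : Matrix (Fin n) (Fin n) A) (b : Matrix (Fin m) (Fin m) A),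
    MatPos a → MatPos b → CuntzSubM (rep (k + 1) a) (rep k b) → CuntzSubM a b


section CoreAlg

variable {B : Type*} [CStarAlgebra B] [PartialOrder B] [StarOrderedRing B]

/-- Positive elements: `0 ≤ x ≤ C • y` implies `x ≾ y`. -/
theorem cuntzSub_of_le_smul {x y : B} (hx : 0 ≤ x) (hy : 0 ≤ y) {C : ℝ} (hC : 0 ≤ C)
    (h : x ≤ C • y) : CuntzSub x y := by
  have key : ∀ ε : ℝ, 0 < ε → ∃ v : B, ‖v * y * star v - x‖ ≤ ε := by
    intro ε hε
    have hCy : 0 ≤ C • y := smul_nonneg hC hy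
    have hε1 : IsStrictlyPositive (algebraMap ℝ B ε) := by
      exact isStrictlyPositive_algebraMap hε
    have hc : IsStrictlyPositive (C • y + algebraMap ℝ B ε) := IsStrictlyPositive.nonneg_add hCy hε1
    set c := C • y + algebraMap ℝ B ε with hcdef
    have hgc := CFC.conjugate_rpow_neg_one_half c hc
    have hg0 : 0 ≤ c ^ (-(1 / 2) : ℝ) := CFC.rpow_nonneg
    set g := c ^ (-(1 / 2) : ℝ) with hg
    have hgs : star g = g := (IsSelfAdjoint.of_nonneg hg0).star_eq
    have hs0 : 0 ≤ CFC.sqrt x := CFC.sqrt_nonneg x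
    have hss : CFC.sqrt x * CFC.sqrt x = x := CFC.sqrt_mul_sqrt_self x hx
    set s := CFC.sqrt x with hs
    have hsstar : star s = s := (IsSelfAdjoint.of_nonneg hs0).star_eq
    have hxc : x ≤ c := h.trans (by rw [hcdef]; exact le_add_of_nonneg_right hε1.nonneg)
    have h1 : g * x * g ≤ 1 := by
      rw [← hgc]
      have := star_left_conjugate_le_conjugate hxc g
      rwa [hgs] at this
    have h0 : 0 ≤ g * x * g := by
      have := star_left_conjugate_nonneg hx g
      rwa [hgs] at this
    have hn : ‖s * g * g * s‖ ≤ 1 := by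
      have e1 : s * g * g * s = star (g * s) * (g * s) := by
        simp only [star_mul, hgs, hsstar, mul_assoc]
      have e2 : g * x * g = (g * s) * star (g * s) := by
        simp only [star_mul, hgs, hsstar, mul_assoc, ← hss]
      rw [e1, CStarRing.norm_star_mul_self, ← CStarRing.norm_self_mul_star, ← e2]
      exact (CStarAlgebra.norm_le_one_iff_of_nonneg _ h0).2 h1
    refine ⟨(Real.sqrt C) • (s * g), ?_⟩
    have e : (Real.sqrt C • (s * g)) * y * star (Real.sqrt C • (s * g)) - x
        = -(ε • (s * g * g * s)) := by
      have e3 : C • y = c - algebraMap ℝ B ε := by rw [hcdef]; abel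
      calc (Real.sqrt C • (s * g)) * y * star (Real.sqrt C • (s * g)) - x
          = s * (g * (C • y) * g) * s - x := by
            rw [star_smul]
            simp only [star_mul, hgs, hsstar, star_trivial, smul_mul_assoc, mul_smul_comm, smul_smul,
              Real.mul_self_sqrt hC, mul_assoc]
        _ = s * (g * c * g) * s - ε • (s * g * g * s) - x := by
            rw [e3, Algebra.algebraMap_eq_smul_one]
            simp only [mul_sub, sub_mul, smul_mul_assoc, mul_smul_comm, mul_one, mul_assoc]
        _ = _ := by rw [hgc, mul_one, hss]; abel
    rw [e, norm_neg, norm_smul, Real.norm_of_nonneg hε.le]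
    nlinarith
  choose v hv using fun n : ℕ => key (1 / ((n : ℝ) + 1)) (by positivity)
  refine ⟨v, ?_⟩
  rw [tendsto_iff_norm_sub_tendsto_zero]
  exact squeeze_zero (fun _ => norm_nonneg _) hv tendsto_one_div_add_atTop_nhds_zero_nat

/-- A projection `p ≾ a` is exactly of the form `x a x*`, with `p x = x`. -/
theorem exists_conj_eq_proj {p a : B} (ha : 0 ≤ a) (hp₁ : IsSelfAdjoint p)
    (hp₂ : IsIdempotentElem p) (h : CuntzSub p a) :
    ∃ x : B, x * a * star x = p ∧ p * x = x := by
  obtain ⟨v, hv⟩ := h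
  rw [tendsto_iff_norm_sub_tendsto_zero] at hv
  obtain ⟨n, hn⟩ := (hv.eventually (gt_mem_nhds (zero_lt_one))).exists
  have hps : star p = p := hp₁.star_eq
  have hpp : p * p = p := hp₂
  set t := v n * a * star (v n) with ht
  have ht0 : 0 ≤ t := star_right_conjugate_nonneg ha _
  have hproj : IsStarProjection p := ⟨hp₂, hp₁⟩
  have hpn : ‖p‖ ≤ 1 := hproj.norm_le
  set c := p * t * p + (1 - p) with hc
  have hc0 : 0 ≤ c := by
    refine add_nonneg ?_ ?_
    · have := star_left_conjugate_nonneg ht0 p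
      rwa [hps] at this
    · exact hproj.one_sub.nonneg
  have hcu : IsUnit c := by
    have e : c = 1 - (-(p * (t - p) * p)) := by
      rw [hc]; simp only [mul_sub, sub_mul, hpp]; abel
    rw [e]
    apply isUnit_one_sub_of_norm_lt_one
    rw [norm_neg]
    calc ‖p * (t - p) * p‖ ≤ ‖p‖ * ‖t - p‖ * ‖p‖ := norm_mul₃_le
      _ ≤ 1 * ‖t - p‖ * 1 := by gcongr
      _ < 1 := by simpa using hn
  have hcs : IsStrictlyPositive c := hcu.isStrictlyPositive hc0
  have hgc := CFC.conjugate_rpow_neg_one_half c hcs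
  have hg0 : 0 ≤ c ^ (-(1 / 2) : ℝ) := CFC.rpow_nonneg
  have hpc : Commute c p := by
    show c * p = p * c
    rw [hc]
    simp only [add_mul, mul_add, sub_mul, mul_sub, mul_assoc, hpp, one_mul, mul_one]
    simp only [← mul_assoc, hpp]
  have hgp : Commute (c ^ (-(1 / 2) : ℝ)) p := by
    rw [CFC.rpow_def]
    exact hpc.cfc_nnreal _
  set g := c ^ (-(1 / 2) : ℝ) with hg
  have hgs : star g = g := (IsSelfAdjoint.of_nonneg hg0).star_eq
  have hgp' : g * p = p * g := hgp
  refine ⟨g * p * v n, ?_, ?_⟩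
  · have e4 : p * c = p * t * p := by
      rw [hc]; simp only [mul_add, mul_sub, mul_one, ← mul_assoc, hpp]; abel
    calc g * p * v n * a * star (g * p * v n) = g * (p * t * p) * g := by
          simp only [ht, star_mul, hps, hgs, mul_assoc]
      _ = p * (g * c * g) := by rw [← e4]; simp only [← mul_assoc, hgp']
      _ = p := by rw [hgc, mul_one]
  · rw [hgp']; simp only [← mul_assoc, hpp]

theorem core_complement {p a : B} (ha : 0 ≤ a) (hp₁ : IsSelfAdjoint p)
    (hp₂ : IsIdempotentElem p) (h : CuntzSub p a) :
    ∃ w b : B, (∃ c, b = star c * c) ∧ star w * w = p ∧ w * star w * b = 0 ∧ b * (w * star w) = 0 ∧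
      w * p = w ∧ CuntzEquiv (w * star w + b) a := by
  obtain ⟨x, hx, hpx⟩ := exists_conj_eq_proj ha hp₁ hp₂ h
  have hps : star p = p := hp₁.star_eq
  have hpp : p * p = p := hp₂
  have hs0 : 0 ≤ CFC.sqrt a := CFC.sqrt_nonneg a
  have hss : CFC.sqrt a * CFC.sqrt a = a := CFC.sqrt_mul_sqrt_self a ha
  set s := CFC.sqrt a with hs
  have hsstar : star s = s := (IsSelfAdjoint.of_nonneg hs0).star_eq
  set w := s * star x with hw
  have hww : star w * w = p := by
    rw [← hx, ← hss, hw]; simp only [star_mul, star_star, hsstar, mul_assoc]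
  have hwp : w * p = w := by
    have : star x * p = star x := by
      have := congrArg star hpx
      rwa [star_mul, hps] at this
    rw [hw, mul_assoc, this]
  set q := w * star w with hq
  have hq1 : star q = q := by rw [hq]; simp
  have hqq : q * q = q := by
    rw [hq]
    calc w * star w * (w * star w) = w * (star w * w) * star w := by simp only [mul_assoc]
      _ = _ := by rw [hww, hwp]
  have hq0 : 0 ≤ q := mul_star_self_nonneg w
  have hqa : q ≤ ‖star x * x‖ • a := by
    have := CStarAlgebra.star_left_conjugate_le_norm_smul (a := s) (b := star x * x)
      (.star_mul_self x)
    rw [hsstar, hss] at this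
    refine le_trans (le_of_eq ?_) this
    rw [hq, hw]; simp only [star_mul, star_star, hsstar, mul_assoc]
  have hqaq : q * a * q ≤ ‖a‖ • q := by
    have := CStarAlgebra.star_left_conjugate_le_norm_smul (a := q) (b := a)
      (IsSelfAdjoint.of_nonneg ha)
    rwa [hq1, hqq] at this
  set b := (1 - q) * a * (1 - q) with hb
  have hb0 : 0 ≤ b := by
    have := star_left_conjugate_nonneg ha (1 - q)
    rwa [star_sub, star_one, hq1] at this
  have hqb : q * b = 0 := by
    rw [hb]; simp only [← mul_assoc, mul_sub, mul_one, hqq, sub_self, zero_mul]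
  have hbq : b * q = 0 := by
    rw [hb]; simp only [mul_assoc, sub_mul, one_mul, hqq, sub_self, mul_zero]
  have hbc : b = star (s * (1 - q)) * (s * (1 - q)) := by
    rw [hb, ← hss]
    simp only [star_mul, star_sub, star_one, hq1, hsstar, mul_assoc]
  refine ⟨w, b, ⟨_, hbc⟩, hww, hqb, hbq, hwp, ?_, ?_⟩
  · set K := ‖star x * x‖ with hK
    have hK0 : 0 ≤ K := norm_nonneg _
    have h2 : b ≤ (2 : ℝ) • a + (2 : ℝ) • (q * a * q) := by
      have h3 : 0 ≤ (1 + q) * a * (1 + q) := by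
        have := star_left_conjugate_nonneg ha (1 + q)
        rwa [star_add, star_one, hq1] at this
      have h4 : (2 : ℝ) • a + (2 : ℝ) • (q * a * q) = b + (1 + q) * a * (1 + q) := by
        rw [hb, two_smul, two_smul]; noncomm_ring
      rw [h4]; exact le_add_of_nonneg_right h3
    refine cuntzSub_of_le_smul (add_nonneg hq0 hb0) ha
      (C := K + (2 + 2 * (‖a‖ * K))) (by positivity) ?_
    have h5 : q * a * q ≤ (‖a‖ * K) • a := by
      refine hqaq.trans ?_
      rw [mul_smul]
      exact smul_le_smul_of_nonneg_left hqa (norm_nonneg _)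
    rw [add_smul, add_smul, mul_smul (2 : ℝ)]
    refine add_le_add hqa (h2.trans ?_)
    gcongr
  · refine cuntzSub_of_le_smul ha (add_nonneg hq0 hb0) (C := 2 * ‖a‖ + 2) (by positivity) ?_
    have h3 : 0 ≤ (2 * q - 1) * a * (2 * q - 1) := by
      have := star_left_conjugate_nonneg ha (2 * q - 1)
      have e : star (2 * q - 1) = 2 * q - 1 := by
        rw [two_mul, star_sub, star_add, star_one, hq1]
      rwa [e] at this
    have h4 : (2 : ℝ) • (q * a * q) + (2 : ℝ) • b = a + (2 * q - 1) * a * (2 * q - 1) := by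
      rw [hb, two_smul, two_smul]; noncomm_ring
    calc a ≤ (2 : ℝ) • (q * a * q) + (2 : ℝ) • b := by
          rw [h4]; exact le_add_of_nonneg_right h3
      _ ≤ (2 : ℝ) • (‖a‖ • q) + (2 : ℝ) • b := by gcongr
      _ ≤ (2 * ‖a‖) • q + (2 : ℝ) • b + (2 • q + (2 * ‖a‖) • b) := by
          rw [mul_smul]
          refine le_add_of_nonneg_right ?_
          positivity
      _ = _ := by
          simp only [add_smul, smul_add, two_smul]; abel

end CoreAlg

section MatPart

open Matrix

/-- Rectangular Cuntz subequivalence for square matrices indexed by different finite types. -/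
def SubR {R : Type*} [CStarAlgebra R] {ι κ : Type*} [Fintype ι] [Fintype κ]
    (X : Matrix ι ι R) (Y : Matrix κ κ R) : Prop :=
  X ∈ closure (Set.range fun v : Matrix ι κ R => v * Y * vᴴ)

variable {R : Type*} [CStarAlgebra R] {ι κ μ : Type*} [Fintype ι] [Fintype κ] [Fintype μ]

theorem subR_iff_cuntzSub (X Y : Matrix ι ι R) : SubR X Y ↔ CuntzSub X Y := by
  unfold SubR CuntzSub
  have : FirstCountableTopology (Matrix ι ι R) :=
    inferInstanceAs (FirstCountableTopology (ι → ι → R))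
  rw [mem_closure_iff_seq_limit]
  constructor
  · rintro ⟨u, hu, hlim⟩
    choose v hv using hu
    refine ⟨v, ?_⟩
    have : (fun n => v n * Y * star (v n)) = u := funext hv
    rwa [this]
  · rintro ⟨v, hv⟩
    exact ⟨_, fun n => ⟨v n, rfl⟩, hv⟩

theorem SubR.of_eq {X : Matrix ι ι R} {Y : Matrix κ κ R} (v : Matrix ι κ R)
    (h : v * Y * vᴴ = X) : SubR X Y := subset_closure ⟨v, h⟩

theorem SubR.trans {X : Matrix ι ι R} {Y : Matrix κ κ R} {Z : Matrix μ μ R}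
    (h₁ : SubR X Y) (h₂ : SubR Y Z) : SubR X Z := by
  refine closure_minimal ?_ isClosed_closure h₁
  rintro _ ⟨v, rfl⟩
  have hc : Continuous fun M : Matrix κ κ R => v * M * vᴴ := by fun_prop
  show v * Y * vᴴ ∈ _
  refine map_mem_closure (f := fun M : Matrix κ κ R => v * M * vᴴ) hc h₂ ?_
  rintro _ ⟨u, rfl⟩
  refine ⟨v * u, ?_⟩
  simp only [conjTranspose_mul, Matrix.mul_assoc]

/-- The isometry implementing the corner embedding. -/
def padJ (R : Type*) [CStarAlgebra R] (n m : ℕ) : Matrix (Fin m) (Fin n) R :=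
  fun i j => if (i : ℕ) = (j : ℕ) then 1 else 0

theorem padJ_isom {n m : ℕ} (h : n ≤ m) : (padJ R n m)ᴴ * padJ R n m = 1 := by
  ext i j
  simp only [Matrix.mul_apply, conjTranspose_apply, padJ, Matrix.one_apply]
  rw [Finset.sum_eq_single (⟨i, i.2.trans_le h⟩ : Fin m)]
  · simp [Fin.ext_iff]
  · intro b _ hb
    have : (b : ℕ) ≠ i := fun e => hb (Fin.ext e)
    simp [this]
  · simp

theorem pad_eq {n m : ℕ} (h : n ≤ m) (X : Matrix (Fin n) (Fin n) R) :
    pad h X = padJ R n m * X * (padJ R n m)ᴴ := by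
  ext i j
  simp only [Matrix.mul_apply, conjTranspose_apply, padJ, pad]
  by_cases hj : (j : ℕ) < n
  · rw [Finset.sum_eq_single (⟨j, hj⟩ : Fin n)]
    · by_cases hi : (i : ℕ) < n
      · rw [Finset.sum_eq_single (⟨i, hi⟩ : Fin n)]
        · simp [hi, hj]
        · intro b _ hb
          have : (i : ℕ) ≠ b := fun e => hb (Fin.ext e.symm)
          simp [this]
        · simp
      · have : ∀ b : Fin n, (i : ℕ) ≠ b := fun b e => hi (e ▸ b.2)
        simp [hi, this]
    · intro b _ hb
      have : (j : ℕ) ≠ b := fun e => hb (Fin.ext e.symm)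
      simp [this]
    · simp
  · have : ∀ b : Fin n, (j : ℕ) ≠ b := fun b e => hj (e ▸ b.2)
    simp [hj, this]

theorem unpad_eq {n m : ℕ} (h : n ≤ m) (X : Matrix (Fin n) (Fin n) R) :
    (padJ R n m)ᴴ * pad h X * padJ R n m = X := by
  rw [pad_eq]
  calc _ = ((padJ R n m)ᴴ * padJ R n m) * X * ((padJ R n m)ᴴ * padJ R n m) := by
        simp only [Matrix.mul_assoc]
    _ = X := by rw [padJ_isom h]; simp

theorem subR_pad {n m : ℕ} (h : n ≤ m) (X : Matrix (Fin n) (Fin n) R) : SubR (pad h X) X :=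
  SubR.of_eq (padJ R n m) (pad_eq h X).symm

theorem subR_unpad {n m : ℕ} (h : n ≤ m) (X : Matrix (Fin n) (Fin n) R) : SubR X (pad h X) :=
  SubR.of_eq (padJ R n m)ᴴ (by rw [conjTranspose_conjTranspose]; exact unpad_eq h X)

theorem cuntzSubM_of_subR {n m : ℕ} {X : Matrix (Fin n) (Fin n) R} {Y : Matrix (Fin m) (Fin m) R}
    (h : SubR X Y) : CuntzSubM X Y :=
  (subR_iff_cuntzSub _ _).1 (((subR_pad _ X).trans h).trans (subR_unpad _ Y))

theorem dsum_eq {n m : ℕ} (X : Matrix (Fin n) (Fin n) R) (Y : Matrix (Fin m) (Fin m) R) :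
    dsum X Y = (Matrix.fromBlocks X 0 0 Y).submatrix finSumFinEquiv.symm finSumFinEquiv.symm := rfl

theorem subR_dsum {n m : ℕ} (X : Matrix (Fin n) (Fin n) R) (Y : Matrix (Fin m) (Fin m) R) :
    SubR (dsum X Y) (Matrix.fromBlocks X 0 0 Y) := by
  refine SubR.of_eq ((1 : Matrix (Fin n ⊕ Fin m) (Fin n ⊕ Fin m) R).submatrix
    finSumFinEquiv.symm id) ?_
  rw [dsum_eq, conjTranspose_submatrix, conjTranspose_one]
  have e : (Matrix.fromBlocks X 0 0 Y) =
    (Matrix.fromBlocks X 0 0 Y).submatrix id id := by simp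
  rw [e, ← Matrix.submatrix_mul _ _ _ _ _ Function.bijective_id,
    ← Matrix.submatrix_mul _ _ _ _ _ Function.bijective_id]
  simp

theorem subR_dsum' {n m : ℕ} (X : Matrix (Fin n) (Fin n) R) (Y : Matrix (Fin m) (Fin m) R) :
    SubR (Matrix.fromBlocks X 0 0 Y) (dsum X Y) := by
  refine SubR.of_eq ((1 : Matrix (Fin n ⊕ Fin m) (Fin n ⊕ Fin m) R).submatrix
    id finSumFinEquiv.symm) ?_
  rw [dsum_eq, conjTranspose_submatrix, conjTranspose_one,
    ← Matrix.submatrix_mul _ _ _ _ _ finSumFinEquiv.symm.bijective,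
    ← Matrix.submatrix_mul _ _ _ _ _ finSumFinEquiv.symm.bijective]
  simp

/-- The core result, for matrices. -/
theorem core_matrix {N : ℕ} (p a : Matrix (Fin N) (Fin N) R) (ha : MatPos a)
    (hp₁ : IsSelfAdjoint p) (hp₂ : IsIdempotentElem p) (h : CuntzSub p a) :
    ∃ w b : Matrix (Fin N) (Fin N) R, MatPos b ∧ star w * w = p ∧ w * star w * b = 0 ∧
      b * (w * star w) = 0 ∧ w * p = w ∧ CuntzEquiv (w * star w + b) a := by
  let _ : PartialOrder R := CStarAlgebra.spectralOrder R
  have : StarOrderedRing R := CStarAlgebra.spectralOrderedRing R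
  have ha' : (0 : CStarMatrix (Fin N) (Fin N) R) ≤ CStarMatrix.ofMatrix a := by
    obtain ⟨c, hc⟩ := ha
    have := star_mul_self_nonneg (CStarMatrix.ofMatrix c)
    rw [hc]
    exact this
  obtain ⟨w, b, hb, h1, h2, h3, h4, h5⟩ :=
    core_complement (B := CStarMatrix (Fin N) (Fin N) R) (p := CStarMatrix.ofMatrix p)
      (a := CStarMatrix.ofMatrix a) ha' hp₁ hp₂ h
  refine ⟨CStarMatrix.ofMatrix.symm w, CStarMatrix.ofMatrix.symm b, ?_, h1, h2, h3, h4, h5⟩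
  obtain ⟨c, hc⟩ := hb
  exact ⟨CStarMatrix.ofMatrix.symm c, hc⟩

end MatPart

open Matrix

/-- If a projection `p` in `M_∞(A)` is Cuntz subequivalent to a positive element `a`,
then `p ⊕ b` is Cuntz equivalent to `a` for some positive `b` in `M_∞(A)`. -/
theorem proj_cuntzSub_implies_complement [CStarAlgebra A] {n m : ℕ}
    (a : Matrix (Fin n) (Fin n) A) (p : Matrix (Fin m) (Fin m) A)
    (ha : MatPos a) (hp₁ : IsSelfAdjoint p) (hp₂ : IsIdempotentElem p)
    (h : CuntzSubM p a) :
    ∃ (k : ℕ) (b : Matrix (Fin k) (Fin k) A), MatPos b ∧ CuntzEquivM (dsum p b) a := by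
  set N := max m n with hN
  have hmN : m ≤ N := le_max_left m n
  have hnN : n ≤ N := le_max_right m n
  have hJp := padJ_isom (R := A) hmN
  have hJa := padJ_isom (R := A) hnN
  have ha' : MatPos (pad hnN a) := by
    obtain ⟨c, hc⟩ := ha
    refine ⟨pad hnN c, ?_⟩
    rw [pad_eq, pad_eq, hc, Matrix.star_eq_conjTranspose, Matrix.star_eq_conjTranspose]
    simp only [Matrix.conjTranspose_mul, Matrix.conjTranspose_conjTranspose, Matrix.mul_assoc]
    rw [← Matrix.mul_assoc _ (padJ A n N), hJa, Matrix.one_mul]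
  have hp₁' : IsSelfAdjoint (pad hmN p) := by
    have : pᴴ = p := hp₁
    show (pad hmN p)ᴴ = _
    rw [pad_eq]
    simp only [Matrix.conjTranspose_mul, Matrix.conjTranspose_conjTranspose, Matrix.mul_assoc, this]
  have hp₂' : IsIdempotentElem (pad hmN p) := by
    have hpp : p * p = p := hp₂
    show pad hmN p * pad hmN p = pad hmN p
    rw [pad_eq]
    calc _ = padJ A m N * (p * ((padJ A m N)ᴴ * padJ A m N) * p) * (padJ A m N)ᴴ := by
          simp only [Matrix.mul_assoc]
      _ = _ := by rw [hJp, Matrix.mul_one, hpp]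
  obtain ⟨w, b, hb, hww, hqb, hbq, hwp, h1, h2⟩ := core_matrix _ _ ha' hp₁' hp₂' h
  rw [Matrix.star_eq_conjTranspose] at *
  set P := pad hmN p with hP
  have hPe : P = padJ A m N * p * (padJ A m N)ᴴ := pad_eq hmN p
  have hpe : (padJ A m N)ᴴ * P * padJ A m N = p := unpad_eq hmN p
  have hPP : P * P = P := hp₂'
  have hwb : wᴴ * b = 0 := by
    have h0 : P * (wᴴ * b) = 0 := by
      rw [← hww]
      calc wᴴ * w * (wᴴ * b) = wᴴ * (w * wᴴ * b) := by simp only [Matrix.mul_assoc]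
        _ = 0 := by rw [hqb, Matrix.mul_zero]
    have h3 : P * wᴴ = wᴴ := by
      have := congrArg Matrix.conjTranspose hwp
      rw [Matrix.conjTranspose_mul] at this
      rwa [show Pᴴ = P from hp₁'] at this
    rwa [← Matrix.mul_assoc, h3] at h0
  have hbw : b * w = 0 := by
    calc b * w = b * (w * P) := by rw [hwp]
      _ = b * (w * wᴴ) * w := by rw [← hww]; simp only [Matrix.mul_assoc]
      _ = 0 := by rw [hbq, Matrix.zero_mul]
  have hbwJ : b * (w * padJ A m N) = 0 := by rw [← Matrix.mul_assoc, hbw, Matrix.zero_mul]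
  have hq : w * P * wᴴ = w * wᴴ := by rw [hwp]
  refine ⟨N, b, hb, ?_, ?_⟩
  · apply cuntzSubM_of_subR
    have k2 : SubR (w * wᴴ + b) a :=
      ((subR_iff_cuntzSub _ _).2 h1).trans (subR_pad hnN a)
    refine (subR_dsum p b).trans (SubR.trans ?_ k2)
    refine SubR.of_eq (Matrix.fromRows ((padJ A m N)ᴴ * wᴴ) (1 - w * wᴴ)) ?_
    rw [Matrix.conjTranspose_fromRows_eq_fromCols_conjTranspose, Matrix.fromRows_mul,
      Matrix.fromRows_mul_fromCols]
    have hsa : (1 - w * wᴴ)ᴴ = 1 - w * wᴴ := by simp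
    have hqq : w * wᴴ * (w * wᴴ) = w * wᴴ := by
      calc _ = w * (wᴴ * w) * wᴴ := by simp only [Matrix.mul_assoc]
        _ = _ := by rw [hww, hwp]
    have e1 : (padJ A m N)ᴴ * wᴴ * (w * wᴴ + b) = (padJ A m N)ᴴ * wᴴ := by
      rw [Matrix.mul_add, Matrix.mul_assoc _ _ b, hwb, Matrix.mul_zero, add_zero]
      calc _ = (padJ A m N)ᴴ * ((wᴴ * w) * wᴴ) := by simp only [Matrix.mul_assoc]
        _ = _ := by
          rw [hww]
          have := congrArg Matrix.conjTranspose hwp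
          rw [Matrix.conjTranspose_mul, show Pᴴ = P from hp₁'] at this
          rw [this]
    have e2 : (1 - w * wᴴ) * (w * wᴴ + b) = b := by
      rw [Matrix.sub_mul, Matrix.one_mul, Matrix.mul_add, hqq, hqb]; abel
    rw [hsa, e1, e2]
    congr 1
    · rw [Matrix.conjTranspose_mul, Matrix.conjTranspose_conjTranspose,
        Matrix.conjTranspose_conjTranspose]
      calc _ = (padJ A m N)ᴴ * (wᴴ * w) * padJ A m N := by simp only [Matrix.mul_assoc]
        _ = p := by rw [hww, hpe]
    · rw [Matrix.mul_sub, Matrix.mul_one, Matrix.mul_assoc, ← Matrix.mul_assoc wᴴ, hww]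
      have := congrArg Matrix.conjTranspose hwp
      rw [Matrix.conjTranspose_mul, show Pᴴ = P from hp₁'] at this
      rw [this, sub_self]
    · rw [Matrix.conjTranspose_mul, Matrix.conjTranspose_conjTranspose,
        Matrix.conjTranspose_conjTranspose, hbwJ]
    · rw [Matrix.mul_sub, hbq, Matrix.mul_one, sub_zero]
  · apply cuntzSubM_of_subR
    have k2 : SubR a (w * wᴴ + b) :=
      (subR_unpad hnN a).trans ((subR_iff_cuntzSub _ _).2 h2)
    refine k2.trans (SubR.trans ?_ (subR_dsum' p b))
    refine SubR.of_eq (Matrix.fromCols (w * padJ A m N) 1) ?_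
    rw [Matrix.conjTranspose_fromCols_eq_fromRows_conjTranspose, Matrix.fromCols_mul_fromBlocks,
      Matrix.fromCols_mul_fromRows]
    simp only [Matrix.mul_zero, add_zero, zero_add, Matrix.one_mul, Matrix.conjTranspose_one,
      Matrix.mul_one, Matrix.conjTranspose_mul]
    congr 1
    rw [← hq, hPe]
    simp only [Matrix.mul_assoc]
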